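/- The eigenvalue of the averaging operator M₁ on the irreducible component H^t of L²(P_s) equals λ_t = (n−s)(s−t) − (s−t+1)t, for 0 ≤ t ≤ s; and if t + s < n then λ_t ≠ −(n−s). -/

import Mathlib

/-- `Pset n s` is the set of `s`-element subsets of `{1,…,n}`. -/
abbrev Pset (n s : ℕ) := {X : Finset (Fin n) // X.card = s}

/-- Pascal-type absorption: `(k+1) C(a,k+1) = (a-k) C(a,k)` over `ℂ`. -/
lemma choose_absorb (a k : ℕ) :
    ((k : ℂ) + 1) * (a.choose (k + 1) : ℂ) = ((a : ℂ) - k) * (a.choose k : ℂ) := by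
  rcases le_or_gt k a with h | h
  · have := Nat.choose_succ_right_eq a k
    have h2 : ((a.choose (k + 1) * (k + 1) : ℕ) : ℂ) = ((a.choose k * (a - k) : ℕ) : ℂ) := by
      rw [this]
    push_cast [Nat.cast_sub h] at h2
    linear_combination h2
  · rw [Nat.choose_eq_zero_of_lt h, Nat.choose_eq_zero_of_lt (by omega)]
    simp

lemma choose_pred_mul (a j : ℕ) :
    (a : ℂ) * ((a - 1).choose j : ℂ) = ((a : ℂ) - j) * (a.choose j : ℂ) := by
  cases a with
  | zero => cases j <;> simp
  | succ a =>
    rw [← choose_absorb]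
    have h := Nat.add_one_mul_choose_eq a j
    have h2 : (((a + 1) * a.choose j : ℕ) : ℂ) = (((a + 1).choose (j + 1) * (j + 1) : ℕ) : ℂ) := by
      rw [h]
    push_cast at h2
    simp only [Nat.add_sub_cancel]
    push_cast
    linear_combination h2

/-- The radial profile, with general coefficients `c`. -/
noncomputable def prof (s t : ℕ) (c : ℕ → ℂ) (u : ℕ) : ℂ :=
  ∑ k ∈ Finset.range (t + 1), c k * ((s - u).choose (t - k) : ℂ) * (u.choose k : ℂ)

lemma prof_rec (s t m N u : ℕ) (c : ℕ → ℂ) (hst : s = t + m) (hu : u ≤ s)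
    (hc : ∀ k < t, ((N : ℂ) - k) * c (k + 1) = -((m : ℂ) + k + 1) * c k) :
    ((s : ℂ) - u) * ((N : ℂ) - u) * prof s t c (u + 1) + (u : ℂ) * u * prof s t c (u - 1)
      + ((u : ℂ) * ((s : ℂ) - u) + (u : ℂ) * ((N : ℂ) - u)) * prof s t c u
    = ((N : ℂ) * m - ((m : ℂ) + 1) * t) * prof s t c u := by
  obtain ⟨a, ha⟩ : ∃ a, a = s - u := ⟨_, rfl⟩
  have hsa : (s : ℂ) = a + u := by
    have : s = a + u := by omega
    exact_mod_cast this
  have hsa' : (a : ℂ) + u = t + m := by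
    have : a + u = t + m := by omega
    exact_mod_cast this
  -- decomposition
  let R : ℕ → ℂ := fun k => c k * (((t : ℂ) - k) * (m + 1 + u) * (a.choose (t - k)) * u.choose k
      + u * (u - k) * u.choose k * (if k = t then 0 else (a.choose (t - k - 1) : ℂ)))
  let S : ℕ → ℂ := fun k => c k * ((k : ℂ) * (N + m + 1 - u) * (a.choose (t - k)) * u.choose k
      + (N - u) * (a - ((t : ℂ) - k)) * a.choose (t - k) *
        (if k = 0 then 0 else (u.choose (k - 1) : ℂ)))
  have key : ((s : ℂ) - u) * ((N : ℂ) - u) * prof s t c (u + 1) + (u : ℂ) * u * prof s t c (u - 1)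
      + ((u : ℂ) * ((s : ℂ) - u) + (u : ℂ) * ((N : ℂ) - u)) * prof s t c u
      - ((N : ℂ) * m - ((m : ℂ) + 1) * t) * prof s t c u
      = ∑ k ∈ Finset.range (t + 1), (R k + S k) := by
    unfold prof
    simp only [Finset.mul_sum, ← Finset.sum_add_distrib, ← Finset.sum_sub_distrib]
    refine Finset.sum_congr rfl fun k hk => ?_
    have hk : k ≤ t := by simpa [Nat.lt_succ_iff] using hk
    have hj : ((t - k : ℕ) : ℂ) = (t : ℂ) - k := by rw [Nat.cast_sub hk]
    have e1 : ((s : ℂ) - u) * ((s - (u + 1)).choose (t - k) : ℂ)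
        = ((a : ℂ) - ((t : ℂ) - k)) * (a.choose (t - k) : ℂ) := by
      have := choose_pred_mul a (t - k)
      rw [hj] at this
      rw [← this, show s - (u + 1) = a - 1 by omega, hsa]
      ring
    have e2 : ((u + 1).choose k : ℂ) = u.choose k + (if k = 0 then 0 else (u.choose (k - 1) : ℂ)) := by
      cases k with
      | zero => simp
      | succ k => simp [Nat.choose_succ_succ]; ring
    have e3 : (u : ℂ) * ((u - 1).choose k : ℂ) = ((u : ℂ) - k) * (u.choose k : ℂ) :=
      choose_pred_mul u k
    have e4 : (u : ℂ) * ((s - (u - 1)).choose (t - k) : ℂ) = 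
        u * (a.choose (t - k) + (if k = t then 0 else (a.choose (t - k - 1) : ℂ))) := by
      rcases Nat.eq_zero_or_pos u with h | h
      · simp [h]
      · rw [show s - (u - 1) = a + 1 by omega]
        congr 1
        split_ifs with h
        · simp [h]
        · obtain ⟨J, hJ⟩ : ∃ J, t - k = J + 1 := ⟨t - k - 1, by omega⟩
          rw [hJ]
          simp [Nat.choose_succ_succ]; ring
    rw [← ha]
    simp only [R, S]
    rw [e2]
    generalize (if k = 0 then 0 else (u.choose (k - 1) : ℂ)) = p at *
    generalize (if k = t then 0 else (a.choose (t - k - 1) : ℂ)) = q at *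
    generalize ((s - (u + 1)).choose (t - k) : ℂ) = x1 at *
    generalize ((s - (u - 1)).choose (t - k) : ℂ) = x2 at *
    generalize ((u - 1).choose k : ℂ) = x3 at *
    generalize (a.choose (t - k) : ℂ) = A at *
    generalize (u.choose k : ℂ) = B at *
    have hm : (m : ℂ) = a + u - t := by linear_combination -hsa'
    have e5 : (u : ℂ) * u * (c k * x2 * x3) = c k * (u * (A + q)) * ((u - k) * B) := by
      rw [← e3, ← e4]; ring
    have e6 : ((s : ℂ) - u) * ((N : ℂ) - u) * (c k * x1 * (B + p))
        = c k * ((N : ℂ) - u) * (((a : ℂ) - ((t : ℂ) - k)) * A) * (B + p) := by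
      rw [← e1]; ring
    rw [e5, e6, hsa, hm]
    ring
  have hz : ∑ k ∈ Finset.range (t + 1), (R k + S k) = 0 := by
    rw [Finset.sum_add_distrib, Finset.sum_range_succ, Finset.sum_range_succ' S]
    have h1 : R t = 0 := by simp [R]
    have h2 : S 0 = 0 := by simp [S]
    rw [h1, h2, add_zero, add_zero, ← Finset.sum_add_distrib]
    refine Finset.sum_eq_zero fun k hk => ?_
    have hk : k < t := by simpa using hk
    obtain ⟨J, rfl⟩ : ∃ J, t = k + 1 + J := ⟨t - (k + 1), by omega⟩
    simp only [R, S]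
    rw [if_neg (by omega), if_neg (by omega), show k + 1 + J - k = J + 1 by omega,
      show k + 1 + J - (k + 1) = J by omega]
    simp only [Nat.add_sub_cancel]
    have f1 := choose_absorb a J
    have f2 := choose_absorb u k
    have f3 := hc k hk
    push_cast at hsa' ⊢
    generalize (a.choose (J + 1) : ℂ) = A1 at *
    generalize (u.choose (k + 1) : ℂ) = B1 at *
    generalize (a.choose J : ℂ) = A at *
    generalize (u.choose k : ℂ) = B at *
    have hm : (m : ℂ) = a + u - (k + 1 + J) := by linear_combination -hsa'
    rw [hm] at f3 ⊢
    linear_combination (c k * (a + u - (k + 1 + J) + 1 + u) * B) * f1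
      + (c (k + 1) * (N + (a + u - (k + 1 + J)) + 1 - u) * A) * f2
      + A * B * (a + u - (k + 1 + J) + 1) * f3
  rw [hz] at key
  linear_combination key

lemma sum_neighbours (n s : ℕ) (X₀ X : Pset n s) (φ : ℕ → ℂ) :
    (∑ X' : Pset n s, if X.1.card - (X.1 ∩ X'.1).card = 1 then
        φ (s - (X₀.1 ∩ X'.1).card) else 0)
    = ∑ p ∈ X.1 ×ˢ X.1ᶜ, (if p.1 ∈ X₀.1 then
        (if p.2 ∈ X₀.1 then φ (s - (X₀.1 ∩ X.1).card) else φ (s - (X₀.1 ∩ X.1).card + 1))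
        else (if p.2 ∈ X₀.1 then φ (s - (X₀.1 ∩ X.1).card - 1)
          else φ (s - (X₀.1 ∩ X.1).card))) := by
  rw [← Finset.sum_filter]
  symm
  obtain ⟨X, hX⟩ := X
  obtain ⟨X₀, hX₀⟩ := X₀
  simp only
  have hcard : ∀ p ∈ X ×ˢ Xᶜ, (insert p.2 (X.erase p.1)).card = s := by
    intro p hp
    simp only [Finset.mem_product, Finset.mem_compl] at hp
    have : 0 < X.card := Finset.card_pos.2 ⟨_, hp.1⟩
    rw [Finset.card_insert_of_notMem (by simp [hp.2]), Finset.card_erase_of_mem hp.1]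
    omega
  refine Finset.sum_bij (fun p hp => (⟨insert p.2 (X.erase p.1), hcard p hp⟩ : Pset n s))
    ?_ ?_ ?_ ?_
  · rintro ⟨x, y⟩ hp
    simp only [Finset.mem_product, Finset.mem_compl] at hp
    have : 0 < X.card := Finset.card_pos.2 ⟨_, hp.1⟩
    have h : X ∩ insert y (X.erase x) = X.erase x := by
      ext z; simp only [Finset.mem_inter, Finset.mem_insert, Finset.mem_erase]
      grind
    simp only [Finset.mem_filter, Finset.mem_univ, true_and]
    rw [h, Finset.card_erase_of_mem hp.1]
    omega
  · rintro ⟨x, y⟩ hp ⟨x', y'⟩ hp' h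
    simp only [Finset.mem_product, Finset.mem_compl] at hp hp'
    simp only [Subtype.mk.injEq, Finset.ext_iff, Finset.mem_insert, Finset.mem_erase] at h
    have h1 := h x
    have h2 := h y
    grind
  · rintro ⟨X', hX'⟩ h
    simp only [Finset.mem_filter, Finset.mem_univ, true_and] at h
    have h1 : (X \ X').card = 1 := by
      have := Finset.card_sdiff_add_card_inter X X'; omega
    have h2 : (X' \ X).card = 1 := by
      have := Finset.card_sdiff_add_card_inter X' X
      have := Finset.card_sdiff_add_card_inter X X'
      rw [Finset.inter_comm] at this
      omega
    obtain ⟨x, hx⟩ := Finset.card_eq_one.1 h1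
    obtain ⟨y, hy⟩ := Finset.card_eq_one.1 h2
    simp only [Finset.ext_iff, Finset.mem_sdiff, Finset.mem_singleton] at hx hy
    refine ⟨(x, y), ?_, ?_⟩
    · simp only [Finset.mem_product, Finset.mem_compl]
      exact ⟨((hx x).2 rfl).1, ((hy y).2 rfl).2⟩
    · simp only [Subtype.mk.injEq]
      ext z
      simp only [Finset.mem_insert, Finset.mem_erase]
      have := hx z
      have := hy z
      tauto
  · rintro ⟨x, y⟩ hp
    simp only [Finset.mem_product, Finset.mem_compl] at hp
    simp only
    have hle : (X₀ ∩ X).card ≤ s := hX₀ ▸ Finset.card_le_card Finset.inter_subset_left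
    by_cases hx : x ∈ X₀ <;> by_cases hy : y ∈ X₀ <;> simp only [hx, hy, if_true, if_false]
    · have h : X₀ ∩ insert y (X.erase x) = insert y ((X₀ ∩ X).erase x) := by
        ext z; simp only [Finset.mem_inter, Finset.mem_insert, Finset.mem_erase]; grind
      have h0 : 0 < (X₀ ∩ X).card := Finset.card_pos.2 ⟨x, by simp [hx, hp.1]⟩
      rw [h, Finset.card_insert_of_notMem (by simp [hp.2]),
        Finset.card_erase_of_mem (by simp [hx, hp.1])]
      congr 1; omega
    · have h : X₀ ∩ insert y (X.erase x) = (X₀ ∩ X).erase x := by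
        ext z; simp only [Finset.mem_inter, Finset.mem_insert, Finset.mem_erase]; grind
      have h0 : 0 < (X₀ ∩ X).card := Finset.card_pos.2 ⟨x, by simp [hx, hp.1]⟩
      rw [h, Finset.card_erase_of_mem (by simp [hx, hp.1])]
      congr 1; omega
    · have h : X₀ ∩ insert y (X.erase x) = insert y (X₀ ∩ X) := by
        ext z; simp only [Finset.mem_inter, Finset.mem_insert, Finset.mem_erase]; grind
      rw [h, Finset.card_insert_of_notMem (by simp [hp.2])]
      congr 1
    · have h : X₀ ∩ insert y (X.erase x) = X₀ ∩ X := by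
        ext z; simp only [Finset.mem_inter, Finset.mem_insert, Finset.mem_erase]; grind
      rw [h]

lemma sum_neighbours' (n s N : ℕ) (hn : n = s + N) (X₀ X : Pset n s) (φ : ℕ → ℂ) (u : ℕ)
    (hu : u = s - (X₀.1 ∩ X.1).card) :
    (∑ X' : Pset n s, if X.1.card - (X.1 ∩ X'.1).card = 1 then
        φ (s - (X₀.1 ∩ X'.1).card) else 0)
    = ((s : ℂ) - u) * ((N : ℂ) - u) * φ (u + 1) + (u : ℂ) * u * φ (u - 1)
      + ((u : ℂ) * ((s : ℂ) - u) + (u : ℂ) * ((N : ℂ) - u)) * φ u := by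
  rw [sum_neighbours, ← hu]
  obtain ⟨X, hX⟩ := X
  obtain ⟨X₀, hX₀⟩ := X₀
  simp only at hu ⊢
  have hle : (X₀ ∩ X).card ≤ s := hX₀ ▸ Finset.card_le_card Finset.inter_subset_left
  have c1 : (X.filter (· ∈ X₀)).card + u = s := by
    rw [Finset.filter_mem_eq_inter, Finset.inter_comm]; omega
  have c2 : (X.filter (· ∉ X₀)).card = u := by
    have := Finset.card_filter_add_card_filter_not (s := X) (· ∈ X₀)
    omega
  have c3 : (Xᶜ.filter (· ∈ X₀)).card = u := by
    have h : Xᶜ.filter (· ∈ X₀) = X₀ \ X := by ext z; simp; tauto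
    rw [h]
    have := Finset.card_sdiff_add_card_inter X₀ X
    omega
  have c4 : (Xᶜ.filter (· ∉ X₀)).card + u = N := by
    have := Finset.card_filter_add_card_filter_not (s := Xᶜ) (· ∈ X₀)
    have h2 := Finset.card_add_card_compl X
    rw [Fintype.card_fin] at h2
    omega
  have c1' : ((X.filter (· ∈ X₀)).card : ℂ) = s - u := by
    rw [← c1]; push_cast; ring
  have c4' : ((Xᶜ.filter (· ∉ X₀)).card : ℂ) = N - u := by
    rw [← c4]; push_cast; ring
  have hX : ∀ (p q : ℂ), ∑ x ∈ X, (if x ∈ X₀ then p else q) = (s - u) * p + u * q := by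
    intro p q
    rw [Finset.sum_ite, Finset.sum_const, Finset.sum_const, nsmul_eq_mul, nsmul_eq_mul, c2, c1']
  have hY : ∀ (p q : ℂ), ∑ x ∈ Xᶜ, (if x ∈ X₀ then p else q) = u * p + (N - u) * q := by
    intro p q
    rw [Finset.sum_ite, Finset.sum_const, Finset.sum_const, nsmul_eq_mul, nsmul_eq_mul, c3, c4']
  have hin : ∀ x, (∑ y ∈ Xᶜ, if x ∈ X₀ then (if y ∈ X₀ then φ u else φ (u + 1))
      else (if y ∈ X₀ then φ (u - 1) else φ u))
      = if x ∈ X₀ then u * φ u + (N - u) * φ (u + 1) else u * φ (u - 1) + (N - u) * φ u := by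
    intro x
    by_cases hx : x ∈ X₀ <;> simp only [hx, if_true, if_false, hY]
  rw [Finset.sum_product]
  simp only [hin, hX]
  ring

/-- The eigenvalue of the averaging operator `M₁` on the irreducible component `H^t` of
`L²(P_s)` (with spherical function `Φ_t`, `s = t + m`) is
`λ_t = (n-s)(s-t) - (s-t+1)t`, and if `t + s < n` then `λ_t ≠ -(n-s)`. -/
theorem stmt9 (n t m : ℕ) (hs : 2 * (t + m) ≤ n) (X₀ : Pset n (t + m)) :
    ∀ (Φ : Pset n (t + m) → ℂ) (lam : ℤ),
      (Φ = fun X =>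
        ∑ k ∈ Finset.Icc (t + (((t + m) - (X₀.1 ∩ X.1).card)) - (t + m))
            (min ((t + m) - (X₀.1 ∩ X.1).card) t),
          (-1 : ℂ) ^ k *
            (Nat.choose ((t + m) - ((t + m) - (X₀.1 ∩ X.1).card)) (t - k)) *
            (Nat.choose ((t + m) - (X₀.1 ∩ X.1).card) k) *
            ((Nat.factorial (m + k) * Nat.factorial (n - (t + m) - k) : ℂ) /
              ((Nat.choose (t + m) t) * Nat.factorial m * Nat.factorial (n - (t + m))))) →
      lam = ((n : ℤ) - (t + m)) * m - (m + 1) * t →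
      (∀ X : Pset n (t + m),
        (∑ X' : Pset n (t + m),
            if X.1.card - (X.1 ∩ X'.1).card = 1 then Φ X' else 0) = (lam : ℂ) * Φ X) ∧
      (t + (t + m) < n → lam ≠ -((n : ℤ) - (t + m))) := by
  intro Φ lam hΦ hlam
  obtain ⟨N, hN⟩ : ∃ N, n = (t + m) + N := ⟨n - (t + m), by omega⟩
  have hnN : n - (t + m) = N := by omega
  constructor
  · let c : ℕ → ℂ := fun k => (-1 : ℂ) ^ k *
      ((Nat.factorial (m + k) * Nat.factorial (N - k) : ℂ) /
              ((Nat.choose (t + m) t) * Nat.factorial m * Nat.factorial N))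
    have hΦ' : ∀ X, Φ X = prof (t + m) t c ((t + m) - (X₀.1 ∩ X.1).card) := by
      intro X
      rw [hΦ]
      simp only [hnN]
      generalize hu : (t + m) - (X₀.1 ∩ X.1).card = u
      have hus : u ≤ t + m := by omega
      unfold prof
      have hsub : Finset.Icc (t + u - (t + m)) (min u t) ⊆ Finset.range (t + 1) := by
        intro k hk
        simp only [Finset.mem_Icc, Finset.mem_range] at hk ⊢
        omega
      rw [← Finset.sum_subset hsub]
      · refine Finset.sum_congr rfl fun k _ => ?_
        simp only [c]
        ring
      · intro k hk hk'
        simp only [Finset.mem_Icc, Finset.mem_range] at hk hk'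
        rcases lt_or_ge u k with h | h
        · simp [Nat.choose_eq_zero_of_lt h]
        · rw [Nat.choose_eq_zero_of_lt (show t + m - u < t - k by omega)]
          simp
    have hc : ∀ k < t, ((N : ℂ) - k) * c (k + 1) = -((m : ℂ) + k + 1) * c k := by
      intro k hk
      obtain ⟨r, hr⟩ : ∃ r, N = k + 1 + r := ⟨N - (k + 1), by omega⟩
      simp only [c]
      rw [show N - k = r + 1 by omega, show N - (k + 1) = r by omega,
        show m + (k + 1) = (m + k) + 1 by omega, Nat.factorial_succ (m + k), Nat.factorial_succ r,
        show (N : ℂ) = k + 1 + r by rw [hr]; push_cast; ring]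
      push_cast
      ring
    intro X
    simp only [hΦ']
    rw [sum_neighbours' n (t + m) N hN X₀ X (prof (t + m) t c) _ rfl,
      prof_rec (t + m) t m N _ c rfl (by omega) hc, hlam]
    have hNc : (n : ℂ) = t + m + N := by exact_mod_cast hN
    push_cast
    rw [hNc]
    ring
  · intro h heq
    rw [hlam, hN] at heq
    have h1 : ((m : ℤ) + 1) * ((N : ℤ) - t) = 0 := by
      push_cast at heq
      linear_combination heq
    rcases mul_eq_zero.1 h1 with h2 | h2 <;> omega
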